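/- arXiv:0804.2801 — 16 statements merged into one kernel-verified Lean document; each statement's English description precedes it below -/
import Mathlib

section
/- Let 𝔤 be a finite-dimensional real Lie algebra equipped with a symmetric bilinear form g and a linear endomorphism J such that J² = −id and g(Jx,Jy) = −g(x,y) for all x,y. Suppose ∇ : 𝔤 × 𝔤 → 𝔤 is a bilinear map satisfying the Koszul identity 2g(∇ₓy, z) = g([x,y],z) + g([z,x],y) + g([z,y],x) for all x, y, z ∈ 𝔤, and define F(x,y,z) := g(∇ₓ(Jy) − J(∇ₓy), z). Then for all x, y, z ∈ 𝔤 the cyclic sum satisfies F(x,y,z) + F(y,z,x) + F(z,x,y) = g([x,Jy] + [y,Jx], z) + g([y,Jz] + [z,Jy], x) + g([z,Jx] + [x,Jz], y). -/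
/-- For a finite-dimensional real Lie algebra with a Norden structure `(J, g)` and a
bilinear map `∇` satisfying the (left-invariant) Koszul identity, the cyclic sum of
`F(x,y,z) = g(∇ₓ(Jy) − J(∇ₓy), z)` equals the stated expression in brackets. -/
theorem cyclic_sum_F_of_koszul
    (L : Type*) [LieRing L] [LieAlgebra ℝ L] [FiniteDimensional ℝ L]
    (g : L →ₗ[ℝ] L →ₗ[ℝ] ℝ) (hgsymm : ∀ x y : L, g x y = g y x)
    (J : L →ₗ[ℝ] L)
    (hJ2 : ∀ x : L, J (J x) = -x)
    (hNorden : ∀ x y : L, g (J x) (J y) = -g x y)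
    (nabla : L →ₗ[ℝ] L →ₗ[ℝ] L)
    (hKoszul : ∀ x y z : L,
      2 * g (nabla x y) z = g ⁅x, y⁆ z + g ⁅z, x⁆ y + g ⁅z, y⁆ x)
    (F : L → L → L → ℝ)
    (hF : ∀ x y z : L, F x y z = g (nabla x (J y) - J (nabla x y)) z) :
    ∀ x y z : L,
      F x y z + F y z x + F z x y =
        g (⁅x, J y⁆ + ⁅y, J x⁆) z + g (⁅y, J z⁆ + ⁅z, J y⁆) x +
          g (⁅z, J x⁆ + ⁅x, J z⁆) y := by
  have hJ_adj : ∀ a b : L, g (J a) b = g a (J b) := fun a b => by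
    have h := hNorden a (J b)
    rw [hJ2, map_neg] at h
    linarith
  have hF_bracket : ∀ x y z : L,
      2 * F x y z = g ⁅x, J y⁆ z + g ⁅z, x⁆ (J y) + g ⁅z, J y⁆ x
        - g ⁅x, y⁆ (J z) + g ⁅x, J z⁆ y + g ⁅y, J z⁆ x := fun x y z => by
    have h₁ := hKoszul x (J y) z
    have h₂ := hKoszul x y (J z)
    rw [← lie_skew (J z) x, ← lie_skew (J z) y, map_neg, map_neg,
      LinearMap.neg_apply, LinearMap.neg_apply] at h₂
    rw [hF, map_sub, LinearMap.sub_apply, hJ_adj]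
    linarith
  intro x y z
  simp only [map_add, LinearMap.add_apply]
  linarith [hF_bracket x y z, hF_bracket y z x, hF_bracket z x y]
end

section
/- Fix real numbers λ₁, λ₂, λ₃, λ₄. The antisymmetric bilinear bracket on ℝ⁴ (with standard basis e₁, e₂, e₃, e₄) determined by [e₁,e₃] = λ₂e₂ + λ₄e₄, [e₂,e₄] = λ₁e₁ + λ₃e₃, [e₂,e₃] = −λ₂e₁ − λ₃e₄, [e₃,e₄] = −λ₄e₁ + λ₃e₂, [e₄,e₁] = λ₁e₂ + λ₄e₃, [e₂,e₁] = −λ₂e₃ + λ₁e₄ satisfies the Jacobi identity [[x,y],z] + [[y,z],x] + [[z,x],y] = 0 for all x, y, z, and hence defines a Lie algebra structure on ℝ⁴. -/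
noncomputable section

/-- The underlying vector space `ℝ⁴`. -/
abbrev V : Type := Fin 4 → ℝ

/-- The standard basis `e₁, e₂, e₃, e₄` of `ℝ⁴` (indexed by `0,…,3`). -/
def e : Fin 4 → V := fun i => Pi.single i 1

/-- The diagonal symmetric bilinear form of signature `(2,2)`:
`g(e₁,e₁)=g(e₂,e₂)=1`, `g(e₃,e₃)=g(e₄,e₄)=−1`, `g(eᵢ,eⱼ)=0` for `i ≠ j`. -/
def gf : V → V → ℝ := fun x y => x 0 * y 0 + x 1 * y 1 - x 2 * y 2 - x 3 * y 3

/-- `εᵢ = g(eᵢ,eᵢ)`, the diagonal entries of the (inverse) metric. -/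
def eps : Fin 4 → ℝ := ![1, 1, -1, -1]

/-- The expansion of a vector in the standard basis. -/
theorem eq_sum_smul_e (x : V) : x = x 0 • e 0 + x 1 • e 1 + x 2 • e 2 + x 3 • e 3 := by
  ext i
  fin_cases i <;> simp [e]

/-- The antisymmetric bilinear bracket on ℝ⁴ determined by the stated values
on the basis satisfies the Jacobi identity, hence defines a Lie algebra. -/
theorem jacobi_identity (l1 l2 l3 l4 : ℝ)
    (B : V →ₗ[ℝ] V →ₗ[ℝ] V)
    (hanti : ∀ x y : V, B x y = -B y x)
    (h13 : B (e 0) (e 2) = l2 • e 1 + l4 • e 3)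
    (h24 : B (e 1) (e 3) = l1 • e 0 + l3 • e 2)
    (h23 : B (e 1) (e 2) = -(l2 • e 0) - l3 • e 3)
    (h34 : B (e 2) (e 3) = -(l4 • e 0) + l3 • e 1)
    (h41 : B (e 3) (e 0) = l1 • e 1 + l4 • e 2)
    (h21 : B (e 1) (e 0) = -(l2 • e 2) + l1 • e 3)
    : ∀ x y z : V, B (B x y) z + B (B y z) x + B (B z x) y = 0 := by
  have self_zero : ∀ x : V, B x x = 0 := fun x => self_eq_neg.mp (hanti x x)
  have bracket_eq : ∀ x y : V, B x y =
      (x 0 * y 2 - x 2 * y 0) • (l2 • e 1 + l4 • e 3)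
      + (x 1 * y 3 - x 3 * y 1) • (l1 • e 0 + l3 • e 2)
      + (x 1 * y 2 - x 2 * y 1) • (-(l2 • e 0) - l3 • e 3)
      + (x 2 * y 3 - x 3 * y 2) • (-(l4 • e 0) + l3 • e 1)
      + (x 3 * y 0 - x 0 * y 3) • (l1 • e 1 + l4 • e 2)
      + (x 1 * y 0 - x 0 * y 1) • (-(l2 • e 2) + l1 • e 3) := by
    intro x y
    conv_lhs => rw [eq_sum_smul_e x, eq_sum_smul_e y]
    simp only [map_add, map_smul, LinearMap.add_apply, LinearMap.smul_apply, self_zero,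
      hanti (e 2) (e 0), hanti (e 3) (e 1), hanti (e 2) (e 1), hanti (e 3) (e 2),
      hanti (e 0) (e 3), hanti (e 0) (e 1), h13, h24, h23, h34, h41, h21]
    module
  intro x y z
  simp only [bracket_eq]
  ext i
  fin_cases i <;> simp [e] <;> ring
end
end

section
/- Fix real numbers λ₁, λ₂, λ₃, λ₄ and let 𝔤 be ℝ⁴ with the antisymmetric bilinear bracket determined by [e₁,e₃] = λ₂e₂ + λ₄e₄, [e₂,e₄] = λ₁e₁ + λ₃e₃, [e₂,e₃] = −λ₂e₁ − λ₃e₄, [e₃,e₄] = −λ₄e₁ + λ₃e₂, [e₄,e₁] = λ₁e₂ + λ₄e₃, [e₂,e₁] = −λ₂e₃ + λ₁e₄. Then the symmetric bilinear form g with g(e₁,e₁) = g(e₂,e₂) = 1, g(e₃,e₃) = g(e₄,e₄) = −1 and g(eᵢ,eⱼ) = 0 for i ≠ j is invariant (ad-invariant): g([x,y],z) + g(y,[x,z]) = 0 for all x, y, z ∈ 𝔤. -/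
noncomputable section

/-- The Norden metric g is ad-invariant for the stated bracket:
g([x,y],z) + g(y,[x,z]) = 0. -/
theorem metric_ad_invariant (l1 l2 l3 l4 : ℝ)
    (B : V →ₗ[ℝ] V →ₗ[ℝ] V)
    (hanti : ∀ x y : V, B x y = -B y x)
    (h13 : B (e 0) (e 2) = l2 • e 1 + l4 • e 3)
    (h24 : B (e 1) (e 3) = l1 • e 0 + l3 • e 2)
    (h23 : B (e 1) (e 2) = -(l2 • e 0) - l3 • e 3)
    (h34 : B (e 2) (e 3) = -(l4 • e 0) + l3 • e 1)
    (h41 : B (e 3) (e 0) = l1 • e 1 + l4 • e 2)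
    (h21 : B (e 1) (e 0) = -(l2 • e 2) + l1 • e 3)
    : ∀ x y z : V, gf (B x y) z + gf y (B x z) = 0 := by
  have hself : ∀ x : V, B x x = 0 := fun x => self_eq_neg.mp (hanti x x)
  have h31 := hanti (e 2) (e 0)
  have h42 := hanti (e 3) (e 1)
  have h32 := hanti (e 2) (e 1)
  have h43 := hanti (e 3) (e 2)
  have h14 := hanti (e 0) (e 3)
  have h12 := hanti (e 0) (e 1)
  rw [h13] at h31
  rw [h24] at h42
  rw [h23] at h32
  rw [h34] at h43
  rw [h41] at h14
  rw [h21] at h12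
  have hexp : ∀ x : V, x = x 0 • e 0 + x 1 • e 1 + x 2 • e 2 + x 3 • e 3 := by
    intro x
    ext i
    fin_cases i <;> simp [e]
  have hB : ∀ x y : V, B x y =
      (x 0 * y 1) • B (e 0) (e 1) + (x 0 * y 2) • B (e 0) (e 2) + (x 0 * y 3) • B (e 0) (e 3)
      + (x 1 * y 0) • B (e 1) (e 0) + (x 1 * y 2) • B (e 1) (e 2) + (x 1 * y 3) • B (e 1) (e 3)
      + (x 2 * y 0) • B (e 2) (e 0) + (x 2 * y 1) • B (e 2) (e 1) + (x 2 * y 3) • B (e 2) (e 3)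
      + (x 3 * y 0) • B (e 3) (e 0) + (x 3 * y 1) • B (e 3) (e 1)
      + (x 3 * y 2) • B (e 3) (e 2) := by
    intro x y
    conv_lhs => rw [hexp x, hexp y]
    simp only [map_add, map_smul, LinearMap.add_apply, LinearMap.smul_apply, hself]
    module
  intro x y z
  rw [hB x y, hB x z, h12, h13, h14, h21, h23, h24, h31, h32, h34, h41, h42, h43]
  simp [gf, e]
  ring
end
end

section
/- Let B : ℝ⁴ × ℝ⁴ → ℝ⁴ be an antisymmetric bilinear map satisfying the Jacobi identity, let g be the symmetric bilinear form on ℝ⁴ with g(e₁,e₁)=g(e₂,e₂)=1, g(e₃,e₃)=g(e₄,e₄)=−1, g(eᵢ,eⱼ)=0 for i≠j, and let J be the linear map with Je₁=e₃, Je₂=e₄, Je₃=−e₁, Je₄=−e₂. Assume g is invariant for B: g(B(x,y),z) + g(y,B(x,z)) = 0 for all x,y,z. Define F(x,y,z) := g((1/2)B(x,Jy) − (1/2)J B(x,y), z). Then the cyclic sum F(x,y,z) + F(y,z,x) + F(z,x,y) vanishes for all x, y, z ∈ ℝ⁴ if and only if there exist real numbers λ₁, λ₂, λ₃, λ₄ such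 that B(e₁,e₃) = λ₂e₂ + λ₄e₄, B(e₂,e₄) = λ₁e₁ + λ₃e₃, B(e₂,e₃) = −λ₂e₁ − λ₃e₄, B(e₃,e₄) = −λ₄e₁ + λ₃e₂, B(e₄,e₁) = λ₁e₂ + λ₄e₃, B(e₂,e₁) = −λ₂e₃ + λ₁e₄. -/
noncomputable section

theorem e_apply (i j : Fin 4) : e i j = if j = i then 1 else 0 := Pi.single_apply i 1 j

theorem gf_e (x : V) (i : Fin 4) : gf x (e i) = eps i * x i := by
  fin_cases i <;> simp [gf, e_apply, eps]

/-- A form `gf` invariant under an antisymmetric `B` yields a cyclic trilinear form. -/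
theorem gf_bracket_cyclic (B : V →ₗ[ℝ] V →ₗ[ℝ] V)
    (hanti : ∀ x y : V, B x y = -B y x)
    (hinv : ∀ x y z : V, gf (B x y) z + gf y (B x z) = 0) (x y z : V) :
    gf (B x y) z = gf (B y z) x := by
  have h := hinv y x z
  rw [hanti y x] at h
  simp only [gf, Pi.neg_apply] at h ⊢
  linarith

/-- The almost complex structure `J` is self-adjoint for the Norden metric `gf`. -/
theorem gf_complexStructure_left (J : V →ₗ[ℝ] V)
    (hJ1 : J (e 0) = e 2) (hJ2 : J (e 1) = e 3)
    (hJ3 : J (e 2) = -e 0) (hJ4 : J (e 3) = -e 1) (x y : V) :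
    gf (J x) y = gf x (J y) := by
  have hJ (x : V) : J x = x 0 • e 2 + x 1 • e 3 - x 2 • e 0 - x 3 • e 1 := by
    conv_lhs => rw [eq_sum_smul_e x]
    simp only [map_add, map_smul, hJ1, hJ2, hJ3, hJ4, smul_neg]
    abel
  rw [hJ x, hJ y]
  simp [gf, e_apply]
  ring

/-- An invariant-metric Lie bracket B on ℝ⁴ gives a quasi-Kähler (𝒲₃) structure
iff B belongs to the 4-parametric family (14). -/
theorem quasi_Kaehler_characterization
    (B : V →ₗ[ℝ] V →ₗ[ℝ] V)
    (hanti : ∀ x y : V, B x y = -B y x)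
    (hJac : ∀ x y z : V, B (B x y) z + B (B y z) x + B (B z x) y = 0)
    (hinv : ∀ x y z : V, gf (B x y) z + gf y (B x z) = 0)
    (J : V →ₗ[ℝ] V)
    (hJ1 : J (e 0) = e 2) (hJ2 : J (e 1) = e 3)
    (hJ3 : J (e 2) = -e 0) (hJ4 : J (e 3) = -e 1)
    (F : V → V → V → ℝ)
    (hF : ∀ x y z : V,
      F x y z = gf ((1 / 2 : ℝ) • B x (J y) - (1 / 2 : ℝ) • J (B x y)) z)
    : (∀ x y z : V, F x y z + F y z x + F z x y = 0) ↔
      ∃ l1 l2 l3 l4 : ℝ,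
        B (e 0) (e 2) = l2 • e 1 + l4 • e 3 ∧
        B (e 1) (e 3) = l1 • e 0 + l3 • e 2 ∧
        B (e 1) (e 2) = -(l2 • e 0) - l3 • e 3 ∧
        B (e 2) (e 3) = -(l4 • e 0) + l3 • e 1 ∧
        B (e 3) (e 0) = l1 • e 1 + l4 • e 2 ∧
        B (e 1) (e 0) = -(l2 • e 2) + l1 • e 3 := by
  constructor
  · intro _
    have hskew (i j k : Fin 4) : B (e i) (e j) k = -B (e j) (e i) k := by
      rw [hanti]
      rfl
    have hcyc (i j k : Fin 4) : eps k * B (e i) (e j) k = eps i * B (e j) (e k) i := by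
      simpa only [gf_e] using gf_bracket_cyclic B hanti hinv (e i) (e j) (e k)
    have hright (i j : Fin 4) : B (e i) (e j) j = 0 := by
      have h := hcyc i j j
      rw [show B (e j) (e j) i = 0 by linarith [hskew j j i], mul_zero] at h
      exact (mul_eq_zero.mp h).resolve_left (by fin_cases j <;> simp [eps])
    have hleft (i j : Fin 4) : B (e i) (e j) i = 0 := by rw [hskew, hright, neg_zero]
    have h012 := hcyc 0 1 2
    have h120 := hcyc 1 2 0
    have h013 := hcyc 0 1 3
    have h130 := hcyc 1 3 0
    have h023 := hcyc 0 2 3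
    have h230 := hcyc 2 3 0
    have h123 := hcyc 1 2 3
    have h231 := hcyc 2 3 1
    simp only [eps, Matrix.cons_val, one_mul, neg_one_mul]
      at h012 h120 h013 h130 h023 h230 h123 h231
    refine ⟨B (e 3) (e 0) 1, B (e 0) (e 2) 1, B (e 1) (e 3) 2, B (e 0) (e 2) 3,
      ?_, ?_, ?_, ?_, ?_, ?_⟩ <;> ext i <;> fin_cases i <;>
      simp [e_apply, hleft, hright] <;>
      linarith [hskew 0 2 1, hskew 1 0 2, hskew 1 0 3, hskew 1 3 2]
  · intro _ x y z
    have hF' (x y z : V) : F x y z = (gf (B x (J y)) z - gf (B x y) (J z)) / 2 := by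
      rw [hF, ← gf_complexStructure_left J hJ1 hJ2 hJ3 hJ4]
      simp only [gf, Pi.sub_apply, Pi.smul_apply, smul_eq_mul]
      ring
    have hcyc := gf_bracket_cyclic B hanti hinv
    rw [hF', hF', hF', hcyc x (J y) z, hcyc (J y) z x, hcyc y (J z) x, hcyc (J z) x y,
      hcyc z (J x) y, hcyc (J x) y z]
    ring
end
end

section
/- Fix real numbers λ₁, λ₂, λ₃, λ₄ and let 𝔤 be the Lie algebra ℝ⁴ with bracket determined by [e₁,e₃] = λ₂e₂ + λ₄e₄, [e₂,e₄] = λ₁e₁ + λ₃e₃, [e₂,e₃] = −λ₂e₁ − λ₃e₄, [e₃,e₄] = −λ₄e₁ + λ₃e₂, [e₄,e₁] = λ₁e₂ + λ₄e₃, [e₂,e₁] = −λ₂e₃ + λ₁e₄, and let J be the linear map with Je₁=e₃, Je₂=e₄, Je₃=−e₁, Je₄=−e₂. Define the Nijenhuis tensor N(x,y) := [x,y] + J[Jx,y] + J[x,Jy] − [Jx,Jy]. Then N(e₁,e₂) = −N(e₃,e₄) = 2(λ₄e₁ − λ₃e₂ + λ₂e₃ − λ₁e₄) and N(e₁,e₄)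 = −N(e₂,e₃) = 2(λ₂e₁ − λ₁e₂ − λ₄e₃ + λ₃e₄), while N(e₁,e₃) = N(e₂,e₄) = 0. -/
noncomputable section

/-- The nonzero components of the Nijenhuis tensor N of J on the basis. -/
theorem nijenhuis_components (l1 l2 l3 l4 : ℝ)
    (B : V →ₗ[ℝ] V →ₗ[ℝ] V)
    (hanti : ∀ x y : V, B x y = -B y x)
    (h13 : B (e 0) (e 2) = l2 • e 1 + l4 • e 3)
    (h24 : B (e 1) (e 3) = l1 • e 0 + l3 • e 2)
    (h23 : B (e 1) (e 2) = -(l2 • e 0) - l3 • e 3)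
    (h34 : B (e 2) (e 3) = -(l4 • e 0) + l3 • e 1)
    (h41 : B (e 3) (e 0) = l1 • e 1 + l4 • e 2)
    (h21 : B (e 1) (e 0) = -(l2 • e 2) + l1 • e 3)
    (hJac : ∀ x y z : V, B (B x y) z + B (B y z) x + B (B z x) y = 0)
    (J : V →ₗ[ℝ] V)
    (hJ1 : J (e 0) = e 2) (hJ2 : J (e 1) = e 3)
    (hJ3 : J (e 2) = -e 0) (hJ4 : J (e 3) = -e 1)
    (N : V → V → V)
    (hN : ∀ x y : V,
      N x y = B x y + J (B (J x) y) + J (B x (J y)) - B (J x) (J y))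
    : N (e 0) (e 1) = (2 : ℝ) • (l4 • e 0 - l3 • e 1 + l2 • e 2 - l1 • e 3) ∧
      N (e 2) (e 3) = -N (e 0) (e 1) ∧
      N (e 0) (e 3) = (2 : ℝ) • (l2 • e 0 - l1 • e 1 - l4 • e 2 + l3 • e 3) ∧
      N (e 1) (e 2) = -N (e 0) (e 3) ∧
      N (e 0) (e 2) = 0 ∧ N (e 1) (e 3) = 0 := by
  have hself (x : V) : B x x = 0 := self_eq_neg.mp (hanti x x)
  have h31 : B (e 2) (e 0) = -(l2 • e 1 + l4 • e 3) := by rw [hanti, h13]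
  have h42 : B (e 3) (e 1) = -(l1 • e 0 + l3 • e 2) := by rw [hanti, h24]
  have h32 : B (e 2) (e 1) = -(-(l2 • e 0) - l3 • e 3) := by rw [hanti, h23]
  have h43 : B (e 3) (e 2) = -(-(l4 • e 0) + l3 • e 1) := by rw [hanti, h34]
  have h14 : B (e 0) (e 3) = -(l1 • e 1 + l4 • e 2) := by rw [hanti, h41]
  have h12 : B (e 0) (e 1) = -(-(l2 • e 2) + l1 • e 3) := by rw [hanti, h21]
  refine ⟨?_, ?_, ?_, ?_, ?_, ?_⟩ <;>
    simp only [hN, hJ1, hJ2, hJ3, hJ4, map_neg, LinearMap.neg_apply, hself, h12, h13, h14, h21,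
      h23, h24, h31, h32, h34, h41, h42, h43, map_add, map_sub, map_smul, map_zero] <;>
    module
end
end

section
/- Fix real numbers λ₁, λ₂, λ₃, λ₄ and let 𝔤 be the Lie algebra ℝ⁴ with bracket determined by [e₁,e₃] = λ₂e₂ + λ₄e₄, [e₂,e₄] = λ₁e₁ + λ₃e₃, [e₂,e₃] = −λ₂e₁ − λ₃e₄, [e₃,e₄] = −λ₄e₁ + λ₃e₂, [e₄,e₁] = λ₁e₂ + λ₄e₃, [e₂,e₁] = −λ₂e₃ + λ₁e₄, g the diagonal form with g(e₁,e₁)=g(e₂,e₂)=1, g(e₃,e₃)=g(e₄,e₄)=−1, g(eᵢ,eⱼ)=0 for i≠j, and J the linear map with Je₁=e₃, Je₂=e₄, Je₃=−e₁, Je₄=−e₂. With ε₁=ε₂=1, ε₃=ε₄=−1 and N(x,y) := [x,y] + J[Jx,y] + J[x,Jy] − [Jx,Jy], the square norm of the Nijenhuis tensor satisfies ‖N‖² := Σ_{i,j=1}^{4} εᵢεⱼ g(N(eᵢ,eⱼ), N(eᵢ,eⱼ)) = −32(λ₁² + λ₂² − λ₃² − λ₄²). -/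
noncomputable section

/-- The square norm of the Nijenhuis tensor: ‖N‖² = −32(λ₁²+λ₂²−λ₃²−λ₄²). -/
theorem nijenhuis_square_norm (l1 l2 l3 l4 : ℝ)
    (B : V →ₗ[ℝ] V →ₗ[ℝ] V)
    (hanti : ∀ x y : V, B x y = -B y x)
    (h13 : B (e 0) (e 2) = l2 • e 1 + l4 • e 3)
    (h24 : B (e 1) (e 3) = l1 • e 0 + l3 • e 2)
    (h23 : B (e 1) (e 2) = -(l2 • e 0) - l3 • e 3)
    (h34 : B (e 2) (e 3) = -(l4 • e 0) + l3 • e 1)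
    (h41 : B (e 3) (e 0) = l1 • e 1 + l4 • e 2)
    (h21 : B (e 1) (e 0) = -(l2 • e 2) + l1 • e 3)
    (hJac : ∀ x y z : V, B (B x y) z + B (B y z) x + B (B z x) y = 0)
    (J : V →ₗ[ℝ] V)
    (hJ1 : J (e 0) = e 2) (hJ2 : J (e 1) = e 3)
    (hJ3 : J (e 2) = -e 0) (hJ4 : J (e 3) = -e 1)
    (N : V → V → V)
    (hN : ∀ x y : V,
      N x y = B x y + J (B (J x) y) + J (B x (J y)) - B (J x) (J y))
    : ∑ i : Fin 4, ∑ j : Fin 4, eps i * eps j * gf (N (e i) (e j)) (N (e i) (e j)) =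
      -32 * (l1 ^ 2 + l2 ^ 2 - l3 ^ 2 - l4 ^ 2) := by
  have h00 : ∀ x : V, B x x = 0 := fun x => self_eq_neg.mp (hanti x x)
  have h31 : B (e 2) (e 0) = -(l2 • e 1 + l4 • e 3) := by rw [hanti, h13]
  have h42 : B (e 3) (e 1) = -(l1 • e 0 + l3 • e 2) := by rw [hanti, h24]
  have h32 : B (e 2) (e 1) = -(-(l2 • e 0) - l3 • e 3) := by rw [hanti, h23]
  have h43 : B (e 3) (e 2) = -(-(l4 • e 0) + l3 • e 1) := by rw [hanti, h34]
  have h14 : B (e 0) (e 3) = -(l1 • e 1 + l4 • e 2) := by rw [hanti, h41]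
  have h12 : B (e 0) (e 1) = -(-(l2 • e 2) + l1 • e 3) := by rw [hanti, h21]
  simp only [Fin.sum_univ_four, hN, hJ1, hJ2, hJ3, hJ4, map_neg, LinearMap.neg_apply, h00,
    h13, h24, h23, h34, h41, h21, h31, h42, h32, h43, h14, h12, map_add, map_sub, map_smul,
    map_zero]
  simp [gf, eps, e]
  ring
end
end

section
/- Fix real numbers λ₁, λ₂, λ₃, λ₄ and let 𝔤 be the Lie algebra ℝ⁴ with bracket determined by [e₁,e₃] = λ₂e₂ + λ₄e₄, [e₂,e₄] = λ₁e₁ + λ₃e₃, [e₂,e₃] = −λ₂e₁ − λ₃e₄, [e₃,e₄] = −λ₄e₁ + λ₃e₂, [e₄,e₁] = λ₁e₂ + λ₄e₃, [e₂,e₁] = −λ₂e₃ + λ₁e₄, g the diagonal form with g(e₁,e₁)=g(e₂,e₂)=1, g(e₃,e₃)=g(e₄,e₄)=−1, g(eᵢ,eⱼ)=0 for i≠j, and J the linear map with Je₁=e₃, Je₂=e₄, Je₃=−e₁, Je₄=−e₂. With ε₁=ε₂=1, ε₃=ε₄=−1 and F(x,y,z) := g((1/2)[x,Jy] − (1/2)J[x,y],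 z), the square norm of ∇J satisfies ‖∇J‖² := Σ_{i,k,p=1}^{4} εᵢεₖεₚ F(eᵢ,eₖ,eₚ)² = 4(λ₁² + λ₂² − λ₃² − λ₄²). -/
noncomputable section

/-- The square norm of ∇J: ‖∇J‖² = 4(λ₁²+λ₂²−λ₃²−λ₄²). -/
theorem nablaJ_square_norm (l1 l2 l3 l4 : ℝ)
    (B : V →ₗ[ℝ] V →ₗ[ℝ] V)
    (hanti : ∀ x y : V, B x y = -B y x)
    (h13 : B (e 0) (e 2) = l2 • e 1 + l4 • e 3)
    (h24 : B (e 1) (e 3) = l1 • e 0 + l3 • e 2)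
    (h23 : B (e 1) (e 2) = -(l2 • e 0) - l3 • e 3)
    (h34 : B (e 2) (e 3) = -(l4 • e 0) + l3 • e 1)
    (h41 : B (e 3) (e 0) = l1 • e 1 + l4 • e 2)
    (h21 : B (e 1) (e 0) = -(l2 • e 2) + l1 • e 3)
    (hJac : ∀ x y z : V, B (B x y) z + B (B y z) x + B (B z x) y = 0)
    (J : V →ₗ[ℝ] V)
    (hJ1 : J (e 0) = e 2) (hJ2 : J (e 1) = e 3)
    (hJ3 : J (e 2) = -e 0) (hJ4 : J (e 3) = -e 1)
    (F : V → V → V → ℝ)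
    (hF : ∀ x y z : V,
      F x y z = gf ((1 / 2 : ℝ) • B x (J y) - (1 / 2 : ℝ) • J (B x y)) z)
    : ∑ i : Fin 4, ∑ k : Fin 4, ∑ p : Fin 4,
        eps i * eps k * eps p * F (e i) (e k) (e p) ^ 2 =
      4 * (l1 ^ 2 + l2 ^ 2 - l3 ^ 2 - l4 ^ 2) := by
  have h31 : B (e 2) (e 0) = -(l2 • e 1 + l4 • e 3) := by rw [hanti, h13]
  have h42 : B (e 3) (e 1) = -(l1 • e 0 + l3 • e 2) := by rw [hanti, h24]
  have h32 : B (e 2) (e 1) = -(-(l2 • e 0) - l3 • e 3) := by rw [hanti, h23]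
  have h43 : B (e 3) (e 2) = -(-(l4 • e 0) + l3 • e 1) := by rw [hanti, h34]
  have h14 : B (e 0) (e 3) = -(l1 • e 1 + l4 • e 2) := by rw [hanti, h41]
  have h12 : B (e 0) (e 1) = -(-(l2 • e 2) + l1 • e 3) := by rw [hanti, h21]
  have hself (x : V) : B x x = 0 := self_eq_neg.mp (hanti x x)
  simp only [Fin.sum_univ_four, hF, hJ1, hJ2, hJ3, hJ4, map_neg, map_add, map_sub, map_smul,
    map_zero, h12, h13, h14, h21, h23, h24, h31, h32, h34, h41, h42, h43, hself]
  simp [gf, e, eps]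
  ring
end
end

section
/- Fix real numbers λ₁, λ₂, λ₃, λ₄ and consider the Lie algebra ℝ⁴ with bracket determined by [e₁,e₃] = λ₂e₂ + λ₄e₄, [e₂,e₄] = λ₁e₁ + λ₃e₃, [e₂,e₃] = −λ₂e₁ − λ₃e₄, [e₃,e₄] = −λ₄e₁ + λ₃e₂, [e₄,e₁] = λ₁e₂ + λ₄e₃, [e₂,e₁] = −λ₂e₃ + λ₁e₄, with g, J, εᵢ, F, N as usual. Then ‖∇J‖² := Σ_{i,k,p} εᵢεₖεₚ F(eᵢ,eₖ,eₚ)² = 0 if and only if ‖N‖² := Σ_{i,j} εᵢεⱼ g(N(eᵢ,eⱼ), N(eᵢ,eⱼ)) = 0; that is, the manifold is isotropic Kähler if and only if its Nijenhuis tensor is isotropic. -/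
noncomputable section

/-- (G,J,g) is isotropic Kähler iff its Nijenhuis tensor is isotropic. -/
theorem isotropic_Kaehler_iff_nijenhuis_isotropic (l1 l2 l3 l4 : ℝ)
    (B : V →ₗ[ℝ] V →ₗ[ℝ] V)
    (hanti : ∀ x y : V, B x y = -B y x)
    (h13 : B (e 0) (e 2) = l2 • e 1 + l4 • e 3)
    (h24 : B (e 1) (e 3) = l1 • e 0 + l3 • e 2)
    (h23 : B (e 1) (e 2) = -(l2 • e 0) - l3 • e 3)
    (h34 : B (e 2) (e 3) = -(l4 • e 0) + l3 • e 1)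
    (h41 : B (e 3) (e 0) = l1 • e 1 + l4 • e 2)
    (h21 : B (e 1) (e 0) = -(l2 • e 2) + l1 • e 3)
    (hJac : ∀ x y z : V, B (B x y) z + B (B y z) x + B (B z x) y = 0)
    (J : V →ₗ[ℝ] V)
    (hJ1 : J (e 0) = e 2) (hJ2 : J (e 1) = e 3)
    (hJ3 : J (e 2) = -e 0) (hJ4 : J (e 3) = -e 1)
    (F : V → V → V → ℝ)
    (hF : ∀ x y z : V,
      F x y z = gf ((1 / 2 : ℝ) • B x (J y) - (1 / 2 : ℝ) • J (B x y)) z)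
    (N : V → V → V)
    (hN : ∀ x y : V,
      N x y = B x y + J (B (J x) y) + J (B x (J y)) - B (J x) (J y))
    : (∑ i : Fin 4, ∑ k : Fin 4, ∑ p : Fin 4,
        eps i * eps k * eps p * F (e i) (e k) (e p) ^ 2) = 0 ↔
      (∑ i : Fin 4, ∑ j : Fin 4,
        eps i * eps j * gf (N (e i) (e j)) (N (e i) (e j))) = 0 := by
  have hself : ∀ x : V, B x x = 0 := fun x => self_eq_neg.mp (hanti x x)
  have h31 := hanti (e 2) (e 0)
  have h42 := hanti (e 3) (e 1)
  have h32 := hanti (e 2) (e 1)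
  have h43 := hanti (e 3) (e 2)
  have h14 := hanti (e 0) (e 3)
  have h12 := hanti (e 0) (e 1)
  rw [h13] at h31
  rw [h24] at h42
  rw [h23] at h32
  rw [h34] at h43
  rw [h41] at h14
  rw [h21] at h12
  have hFsum : (∑ i : Fin 4, ∑ k : Fin 4, ∑ p : Fin 4,
      eps i * eps k * eps p * F (e i) (e k) (e p) ^ 2) =
      4 * (l1 ^ 2 + l2 ^ 2 - l3 ^ 2 - l4 ^ 2) := by
    simp only [Fin.sum_univ_four, hF, hJ1, hJ2, hJ3, hJ4, map_neg, map_add, map_sub, map_smul,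
      map_zero, hself, h13, h24, h23, h34, h41, h21, h31, h42, h32, h43, h14, h12]
    simp [gf, eps, e]
    ring
  have hNsum : (∑ i : Fin 4, ∑ j : Fin 4,
      eps i * eps j * gf (N (e i) (e j)) (N (e i) (e j))) =
      -32 * (l1 ^ 2 + l2 ^ 2 - l3 ^ 2 - l4 ^ 2) := by
    simp only [Fin.sum_univ_four, hN, hJ1, hJ2, hJ3, hJ4, map_neg, map_add, map_sub, map_smul,
      map_zero, LinearMap.neg_apply, hself, h13, h24, h23, h34, h41, h21, h31, h42, h32, h43,
      h14, h12]
    simp [gf, eps, e]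
    ring
  rw [hFsum, hNsum]
  constructor <;> intro h <;> linarith
end
end

section
/- Fix real numbers λ₁, λ₂, λ₃, λ₄ and consider the Lie algebra ℝ⁴ with bracket determined by [e₁,e₃] = λ₂e₂ + λ₄e₄, [e₂,e₄] = λ₁e₁ + λ₃e₃, [e₂,e₃] = −λ₂e₁ − λ₃e₄, [e₃,e₄] = −λ₄e₁ + λ₃e₂, [e₄,e₁] = λ₁e₂ + λ₄e₃, [e₂,e₁] = −λ₂e₃ + λ₁e₄, with g, J, εᵢ, F as usual. Then ‖∇J‖² := Σ_{i,k,p} εᵢεₖεₚ F(eᵢ,eₖ,eₚ)² = 0 if and only if λ₁² + λ₂² − λ₃² − λ₄² = 0. -/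
noncomputable section

/-- (G,J,g) is isotropic Kähler iff λ₁²+λ₂²−λ₃²−λ₄² = 0. -/
theorem isotropic_Kaehler_iff_lambda (l1 l2 l3 l4 : ℝ)
    (B : V →ₗ[ℝ] V →ₗ[ℝ] V)
    (hanti : ∀ x y : V, B x y = -B y x)
    (h13 : B (e 0) (e 2) = l2 • e 1 + l4 • e 3)
    (h24 : B (e 1) (e 3) = l1 • e 0 + l3 • e 2)
    (h23 : B (e 1) (e 2) = -(l2 • e 0) - l3 • e 3)
    (h34 : B (e 2) (e 3) = -(l4 • e 0) + l3 • e 1)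
    (h41 : B (e 3) (e 0) = l1 • e 1 + l4 • e 2)
    (h21 : B (e 1) (e 0) = -(l2 • e 2) + l1 • e 3)
    (hJac : ∀ x y z : V, B (B x y) z + B (B y z) x + B (B z x) y = 0)
    (J : V →ₗ[ℝ] V)
    (hJ1 : J (e 0) = e 2) (hJ2 : J (e 1) = e 3)
    (hJ3 : J (e 2) = -e 0) (hJ4 : J (e 3) = -e 1)
    (F : V → V → V → ℝ)
    (hF : ∀ x y z : V,
      F x y z = gf ((1 / 2 : ℝ) • B x (J y) - (1 / 2 : ℝ) • J (B x y)) z)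
    : (∑ i : Fin 4, ∑ k : Fin 4, ∑ p : Fin 4,
        eps i * eps k * eps p * F (e i) (e k) (e p) ^ 2) = 0 ↔
      l1 ^ 2 + l2 ^ 2 - l3 ^ 2 - l4 ^ 2 = 0 := by
  have hself : ∀ x : V, B x x = 0 := fun x => self_eq_neg.mp (hanti x x)
  have h31 := hanti (e 2) (e 0)
  have h42 := hanti (e 3) (e 1)
  have h32 := hanti (e 2) (e 1)
  have h43 := hanti (e 3) (e 2)
  have h14 := hanti (e 0) (e 3)
  have h12 := hanti (e 0) (e 1)
  rw [h13] at h31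
  rw [h24] at h42
  rw [h23] at h32
  rw [h34] at h43
  rw [h41] at h14
  rw [h21] at h12
  have key : (∑ i : Fin 4, ∑ k : Fin 4, ∑ p : Fin 4,
      eps i * eps k * eps p * F (e i) (e k) (e p) ^ 2) =
        4 * (l1 ^ 2 + l2 ^ 2 - l3 ^ 2 - l4 ^ 2) := by
    simp only [Fin.sum_univ_four, hF, hJ1, hJ2, hJ3, hJ4, map_add, map_sub, map_neg, map_smul,
      map_zero, hself, h13, h24, h23, h34, h41, h21, h31, h42, h32, h43, h14, h12]
    simp [gf, eps, e]
    ring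
  rw [key]
  constructor <;> intro h <;> linarith
end
end

section
/- Fix real numbers λ₁, λ₂, λ₃, λ₄ and let 𝔤 be the Lie algebra ℝ⁴ with bracket determined by [e₁,e₃] = λ₂e₂ + λ₄e₄, [e₂,e₄] = λ₁e₁ + λ₃e₃, [e₂,e₃] = −λ₂e₁ − λ₃e₄, [e₃,e₄] = −λ₄e₁ + λ₃e₂, [e₄,e₁] = λ₁e₂ + λ₄e₃, [e₂,e₁] = −λ₂e₃ + λ₁e₄, and g the diagonal form of signature (2,2). Define R(x,y,z,u) := −(1/4) g([[x,y],z], u). Then R(e₁,e₂,e₂,e₁) = −(1/4)(λ₁²+λ₂²), R(e₁,e₃,e₃,e₁) = (1/4)(λ₂²−λ₄²), R(e₁,e₄,e₄,e₁) = (1/4)(λ₁²−λ₄²), R(e₂,e₃,e₃,e₂) = (1/4)(λ₂²−λ₃²), R(e₂,e₄,e₄,e₂) = (1/4)(λ₁²−λ₃²), and R(e₃,e₄,e₄,e₃) = (1/4)(λ₃²+λ₄²). -/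
noncomputable section

/-- The basic nonzero components of the (0,4)-curvature tensor R. -/
theorem curvature_components (l1 l2 l3 l4 : ℝ)
    (B : V →ₗ[ℝ] V →ₗ[ℝ] V)
    (hanti : ∀ x y : V, B x y = -B y x)
    (h13 : B (e 0) (e 2) = l2 • e 1 + l4 • e 3)
    (h24 : B (e 1) (e 3) = l1 • e 0 + l3 • e 2)
    (h23 : B (e 1) (e 2) = -(l2 • e 0) - l3 • e 3)
    (h34 : B (e 2) (e 3) = -(l4 • e 0) + l3 • e 1)
    (h41 : B (e 3) (e 0) = l1 • e 1 + l4 • e 2)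
    (h21 : B (e 1) (e 0) = -(l2 • e 2) + l1 • e 3)
    (hJac : ∀ x y z : V, B (B x y) z + B (B y z) x + B (B z x) y = 0)
    (R : V → V → V → V → ℝ)
    (hR : ∀ x y z u : V, R x y z u = -(1 / 4 : ℝ) * gf (B (B x y) z) u)
    : R (e 0) (e 1) (e 1) (e 0) = -(1 / 4 : ℝ) * (l1 ^ 2 + l2 ^ 2) ∧
      R (e 0) (e 2) (e 2) (e 0) = (1 / 4 : ℝ) * (l2 ^ 2 - l4 ^ 2) ∧
      R (e 0) (e 3) (e 3) (e 0) = (1 / 4 : ℝ) * (l1 ^ 2 - l4 ^ 2) ∧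
      R (e 1) (e 2) (e 2) (e 1) = (1 / 4 : ℝ) * (l2 ^ 2 - l3 ^ 2) ∧
      R (e 1) (e 3) (e 3) (e 1) = (1 / 4 : ℝ) * (l1 ^ 2 - l3 ^ 2) ∧
      R (e 2) (e 3) (e 3) (e 2) = (1 / 4 : ℝ) * (l3 ^ 2 + l4 ^ 2) := by
  have h42 : B (e 3) (e 1) = -(l1 • e 0 + l3 • e 2) := by rw [hanti, h24]
  have h32 : B (e 2) (e 1) = -(-(l2 • e 0) - l3 • e 3) := by rw [hanti, h23]
  have h43 : B (e 3) (e 2) = -(-(l4 • e 0) + l3 • e 1) := by rw [hanti, h34]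
  have h14 : B (e 0) (e 3) = -(l1 • e 1 + l4 • e 2) := by rw [hanti, h41]
  have h12 : B (e 0) (e 1) = -(-(l2 • e 2) + l1 • e 3) := by rw [hanti, h21]
  refine ⟨?_, ?_, ?_, ?_, ?_, ?_⟩ <;>
  · simp only [hR, h13, h24, h23, h34, h42, h32, h43, h14, h12, map_add, map_sub,
      map_neg, map_smul, LinearMap.add_apply, LinearMap.sub_apply, LinearMap.neg_apply,
      LinearMap.smul_apply]
    simp [gf, e]
    ring
end
end

section
/- Fix real numbers λ₁, λ₂, λ₃, λ₄ and let 𝔤 be the Lie algebra ℝ⁴ with bracket determined by [e₁,e₃] = λ₂e₂ + λ₄e₄, [e₂,e₄] = λ₁e₁ + λ₃e₃, [e₂,e₃] = −λ₂e₁ − λ₃e₄, [e₃,e₄] = −λ₄e₁ + λ₃e₂, [e₄,e₁] = λ₁e₂ + λ₄e₃, [e₂,e₁] = −λ₂e₃ + λ₁e₄, g the diagonal form of signature (2,2), R(x,y,z,u) := −(1/4) g([[x,y],z],u), ε₁=ε₂=1, ε₃=ε₄=−1, and ρ(y,z) := Σᵢ εᵢ R(eᵢ,y,z,eᵢ). Then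 ρ(e₁,e₁) = −(1/2)(λ₁²+λ₂²−λ₄²), ρ(e₂,e₂) = −(1/2)(λ₁²+λ₂²−λ₃²), ρ(e₃,e₃) = (1/2)(λ₂²−λ₃²−λ₄²), and ρ(e₄,e₄) = (1/2)(λ₁²−λ₃²−λ₄²). -/
noncomputable section

/-- The diagonal components of the Ricci tensor ρ. -/
theorem ricci_components (l1 l2 l3 l4 : ℝ)
    (B : V →ₗ[ℝ] V →ₗ[ℝ] V)
    (hanti : ∀ x y : V, B x y = -B y x)
    (h13 : B (e 0) (e 2) = l2 • e 1 + l4 • e 3)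
    (h24 : B (e 1) (e 3) = l1 • e 0 + l3 • e 2)
    (h23 : B (e 1) (e 2) = -(l2 • e 0) - l3 • e 3)
    (h34 : B (e 2) (e 3) = -(l4 • e 0) + l3 • e 1)
    (h41 : B (e 3) (e 0) = l1 • e 1 + l4 • e 2)
    (h21 : B (e 1) (e 0) = -(l2 • e 2) + l1 • e 3)
    (hJac : ∀ x y z : V, B (B x y) z + B (B y z) x + B (B z x) y = 0)
    (R : V → V → V → V → ℝ)
    (hR : ∀ x y z u : V, R x y z u = -(1 / 4 : ℝ) * gf (B (B x y) z) u)
    (ρ : V → V → ℝ)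
    (hρ : ∀ y z : V, ρ y z = ∑ i : Fin 4, eps i * R (e i) y z (e i))
    : ρ (e 0) (e 0) = -(1 / 2 : ℝ) * (l1 ^ 2 + l2 ^ 2 - l4 ^ 2) ∧
      ρ (e 1) (e 1) = -(1 / 2 : ℝ) * (l1 ^ 2 + l2 ^ 2 - l3 ^ 2) ∧
      ρ (e 2) (e 2) = (1 / 2 : ℝ) * (l2 ^ 2 - l3 ^ 2 - l4 ^ 2) ∧
      ρ (e 3) (e 3) = (1 / 2 : ℝ) * (l1 ^ 2 - l3 ^ 2 - l4 ^ 2) := by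
  have hdiag : ∀ x : V, B x x = 0 := fun x => self_eq_neg.mp (hanti x x)
  have h31 : B (e 2) (e 0) = -(l2 • e 1 + l4 • e 3) := by rw [hanti, h13]
  have h42 : B (e 3) (e 1) = -(l1 • e 0 + l3 • e 2) := by rw [hanti, h24]
  have h32 : B (e 2) (e 1) = -(-(l2 • e 0) - l3 • e 3) := by rw [hanti, h23]
  have h43 : B (e 3) (e 2) = -(-(l4 • e 0) + l3 • e 1) := by rw [hanti, h34]
  have h14 : B (e 0) (e 3) = -(l1 • e 1 + l4 • e 2) := by rw [hanti, h41]
  have h12 : B (e 0) (e 1) = -(-(l2 • e 2) + l1 • e 3) := by rw [hanti, h21]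
  simp only [hρ, hR, Fin.sum_univ_four, hdiag, h13, h24, h23, h34, h41, h21, h31, h42, h32, h43,
    h14, h12, map_add, map_sub, map_neg, map_smul, map_zero, LinearMap.add_apply,
    LinearMap.sub_apply, LinearMap.neg_apply, LinearMap.smul_apply, LinearMap.zero_apply]
  refine ⟨?_, ?_, ?_, ?_⟩ <;> simp [gf, eps, e] <;> ring
end
end

section
/- Fix real numbers λ₁, λ₂, λ₃, λ₄ and let 𝔤 be the Lie algebra ℝ⁴ with bracket determined by [e₁,e₃] = λ₂e₂ + λ₄e₄, [e₂,e₄] = λ₁e₁ + λ₃e₃, [e₂,e₃] = −λ₂e₁ − λ₃e₄, [e₃,e₄] = −λ₄e₁ + λ₃e₂, [e₄,e₁] = λ₁e₂ + λ₄e₃, [e₂,e₁] = −λ₂e₃ + λ₁e₄, g the diagonal form of signature (2,2), R(x,y,z,u) := −(1/4) g([[x,y],z],u), ε₁=ε₂=1, ε₃=ε₄=−1, ρ(y,z) := Σᵢ εᵢ R(eᵢ,y,z,eᵢ). Then the scalar curvature τ := Σᵢ εᵢ ρ(eᵢ,eᵢ) equals −(3/2)(λ₁² + λ₂² − λ₃²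 − λ₄²); in particular τ is a constant independent of the point of the group. -/
noncomputable section

/-- The scalar curvature τ = −(3/2)(λ₁²+λ₂²−λ₃²−λ₄²), a constant. -/
theorem scalar_curvature (l1 l2 l3 l4 : ℝ)
    (B : V →ₗ[ℝ] V →ₗ[ℝ] V)
    (hanti : ∀ x y : V, B x y = -B y x)
    (h13 : B (e 0) (e 2) = l2 • e 1 + l4 • e 3)
    (h24 : B (e 1) (e 3) = l1 • e 0 + l3 • e 2)
    (h23 : B (e 1) (e 2) = -(l2 • e 0) - l3 • e 3)
    (h34 : B (e 2) (e 3) = -(l4 • e 0) + l3 • e 1)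
    (h41 : B (e 3) (e 0) = l1 • e 1 + l4 • e 2)
    (h21 : B (e 1) (e 0) = -(l2 • e 2) + l1 • e 3)
    (hJac : ∀ x y z : V, B (B x y) z + B (B y z) x + B (B z x) y = 0)
    (R : V → V → V → V → ℝ)
    (hR : ∀ x y z u : V, R x y z u = -(1 / 4 : ℝ) * gf (B (B x y) z) u)
    (ρ : V → V → ℝ)
    (hρ : ∀ y z : V, ρ y z = ∑ i : Fin 4, eps i * R (e i) y z (e i))
    (τ : ℝ) (hτ : τ = ∑ i : Fin 4, eps i * ρ (e i) (e i))
    : τ = -(3 / 2 : ℝ) * (l1 ^ 2 + l2 ^ 2 - l3 ^ 2 - l4 ^ 2) := by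
  have hself (x : V) : B x x = 0 := self_eq_neg.mp (hanti x x)
  have h31 := hanti (e 2) (e 0)
  have h42 := hanti (e 3) (e 1)
  have h32 := hanti (e 2) (e 1)
  have h43 := hanti (e 3) (e 2)
  have h14 := hanti (e 0) (e 3)
  have h12 := hanti (e 0) (e 1)
  rw [h13] at h31
  rw [h24] at h42
  rw [h23] at h32
  rw [h34] at h43
  rw [h41] at h14
  rw [h21] at h12
  simp only [hτ, hρ, hR, Fin.sum_univ_four, hself, h12, h13, h14, h21, h23, h24, h31, h32, h34,
    h41, h42, h43, map_add, map_sub, map_neg, map_smul, map_zero, LinearMap.add_apply,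
    LinearMap.sub_apply, LinearMap.neg_apply, LinearMap.smul_apply, LinearMap.zero_apply]
  simp [gf, eps, e]
  ring
end
end

section
/- Fix real numbers λ₁, λ₂, λ₃, λ₄ and consider the Lie algebra ℝ⁴ with bracket determined by [e₁,e₃] = λ₂e₂ + λ₄e₄, [e₂,e₄] = λ₁e₁ + λ₃e₃, [e₂,e₃] = −λ₂e₁ − λ₃e₄, [e₃,e₄] = −λ₄e₁ + λ₃e₂, [e₄,e₁] = λ₁e₂ + λ₄e₃, [e₂,e₁] = −λ₂e₃ + λ₁e₄, with g, J, εᵢ, F, R, ρ, τ as usual. Then ‖∇J‖² := Σ_{i,k,p} εᵢεₖεₚ F(eᵢ,eₖ,eₚ)² = 0 if and only if τ := Σᵢ εᵢ ρ(eᵢ,eᵢ) = 0; that is, the manifold is isotropic Kähler if and only if it is scalar flat. -/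
noncomputable section

/-- (G,J,g) is isotropic Kähler iff it is scalar flat. -/
theorem isotropic_Kaehler_iff_scalar_flat (l1 l2 l3 l4 : ℝ)
    (B : V →ₗ[ℝ] V →ₗ[ℝ] V)
    (hanti : ∀ x y : V, B x y = -B y x)
    (h13 : B (e 0) (e 2) = l2 • e 1 + l4 • e 3)
    (h24 : B (e 1) (e 3) = l1 • e 0 + l3 • e 2)
    (h23 : B (e 1) (e 2) = -(l2 • e 0) - l3 • e 3)
    (h34 : B (e 2) (e 3) = -(l4 • e 0) + l3 • e 1)
    (h41 : B (e 3) (e 0) = l1 • e 1 + l4 • e 2)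
    (h21 : B (e 1) (e 0) = -(l2 • e 2) + l1 • e 3)
    (hJac : ∀ x y z : V, B (B x y) z + B (B y z) x + B (B z x) y = 0)
    (J : V →ₗ[ℝ] V)
    (hJ1 : J (e 0) = e 2) (hJ2 : J (e 1) = e 3)
    (hJ3 : J (e 2) = -e 0) (hJ4 : J (e 3) = -e 1)
    (F : V → V → V → ℝ)
    (hF : ∀ x y z : V,
      F x y z = gf ((1 / 2 : ℝ) • B x (J y) - (1 / 2 : ℝ) • J (B x y)) z)
    (R : V → V → V → V → ℝ)
    (hR : ∀ x y z u : V, R x y z u = -(1 / 4 : ℝ) * gf (B (B x y) z) u)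
    (ρ : V → V → ℝ)
    (hρ : ∀ y z : V, ρ y z = ∑ i : Fin 4, eps i * R (e i) y z (e i))
    (τ : ℝ) (hτ : τ = ∑ i : Fin 4, eps i * ρ (e i) (e i))
    : (∑ i : Fin 4, ∑ k : Fin 4, ∑ p : Fin 4,
        eps i * eps k * eps p * F (e i) (e k) (e p) ^ 2) = 0 ↔ τ = 0 := by
  have hself : ∀ x : V, B x x = 0 := fun x => self_eq_neg.mp (hanti x x)
  have h31 : B (e 2) (e 0) = -(l2 • e 1 + l4 • e 3) := by rw [hanti, h13]
  have h42 : B (e 3) (e 1) = -(l1 • e 0 + l3 • e 2) := by rw [hanti, h24]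
  have h32 : B (e 2) (e 1) = -(-(l2 • e 0) - l3 • e 3) := by rw [hanti, h23]
  have h43 : B (e 3) (e 2) = -(-(l4 • e 0) + l3 • e 1) := by rw [hanti, h34]
  have h14 : B (e 0) (e 3) = -(l1 • e 1 + l4 • e 2) := by rw [hanti, h41]
  have h12 : B (e 0) (e 1) = -(-(l2 • e 2) + l1 • e 3) := by rw [hanti, h21]
  have hnorm : (∑ i : Fin 4, ∑ k : Fin 4, ∑ p : Fin 4,
      eps i * eps k * eps p * F (e i) (e k) (e p) ^ 2) =
      4 * (l1 ^ 2 + l2 ^ 2 - l3 ^ 2 - l4 ^ 2) := by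
    simp only [Fin.sum_univ_four, hF, hself, h12, h13, h14, h21, h23, h24, h31, h32, h34, h41,
      h42, h43, hJ1, hJ2, hJ3, hJ4, map_add, map_sub, map_neg, map_smul, map_zero]
    simp [gf, eps, e]
    ring
  have hscalar : τ = -(3 / 2) * (l1 ^ 2 + l2 ^ 2 - l3 ^ 2 - l4 ^ 2) := by
    simp only [hτ, hρ, hR, Fin.sum_univ_four, hself, h12, h13, h14, h21, h23, h24, h31, h32, h34,
      h41, h42, h43, map_add, map_sub, map_neg, map_smul, map_zero, LinearMap.add_apply,
      LinearMap.sub_apply, LinearMap.neg_apply, LinearMap.smul_apply, LinearMap.zero_apply]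
    simp [gf, eps, e]
    ring
  rw [hnorm, hscalar]
  constructor <;> intro h <;> linarith
end
end

section
/- Fix real numbers λ₁, λ₂, λ₃, λ₄ and let 𝔤 be the Lie algebra ℝ⁴ with bracket determined by [e₁,e₃] = λ₂e₂ + λ₄e₄, [e₂,e₄] = λ₁e₁ + λ₃e₃, [e₂,e₃] = −λ₂e₁ − λ₃e₄, [e₃,e₄] = −λ₄e₁ + λ₃e₂, [e₄,e₁] = λ₁e₂ + λ₄e₃, [e₂,e₁] = −λ₂e₃ + λ₁e₄, g the diagonal form of signature (2,2), and R(x,y,z,u) := −(1/4) g([[x,y],z],u). Then the curvature tensor is parallel (the manifold is locally symmetric): for all v, x, y, z, u ∈ 𝔤, R([v,x],y,z,u) + R(x,[v,y],z,u) + R(x,y,[v,z],u) + R(x,y,z,[v,u]) = 0. -/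
noncomputable section

/-- The curvature tensor is parallel: (G,J,g) is locally symmetric. -/
theorem locally_symmetric (l1 l2 l3 l4 : ℝ)
    (B : V →ₗ[ℝ] V →ₗ[ℝ] V)
    (hanti : ∀ x y : V, B x y = -B y x)
    (h13 : B (e 0) (e 2) = l2 • e 1 + l4 • e 3)
    (h24 : B (e 1) (e 3) = l1 • e 0 + l3 • e 2)
    (h23 : B (e 1) (e 2) = -(l2 • e 0) - l3 • e 3)
    (h34 : B (e 2) (e 3) = -(l4 • e 0) + l3 • e 1)
    (h41 : B (e 3) (e 0) = l1 • e 1 + l4 • e 2)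
    (h21 : B (e 1) (e 0) = -(l2 • e 2) + l1 • e 3)
    (hJac : ∀ x y z : V, B (B x y) z + B (B y z) x + B (B z x) y = 0)
    (R : V → V → V → V → ℝ)
    (hR : ∀ x y z u : V, R x y z u = -(1 / 4 : ℝ) * gf (B (B x y) z) u)
    : ∀ v x y z u : V,
      R (B v x) y z u + R x (B v y) z u + R x y (B v z) u + R x y z (B v u) = 0 := by
  have expand (w : V) : w = w 0 • e 0 + w 1 • e 1 + w 2 • e 2 + w 3 • e 3 := by
    ext i
    fin_cases i <;> simp [e]
  have hself (x : V) : B x x = 0 := self_eq_neg.mp (hanti x x)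
  have hB (x y : V) (k : Fin 4) : B x y k =
      (x 2 * y 3 - x 3 * y 2) * (-(l4 • e 0) + l3 • e 1) k
      + (x 0 * y 2 - x 2 * y 0) * (l2 • e 1 + l4 • e 3) k
      + (x 1 * y 3 - x 3 * y 1) * (l1 • e 0 + l3 • e 2) k
      + (x 1 * y 2 - x 2 * y 1) * (-(l2 • e 0) - l3 • e 3) k
      + (x 3 * y 0 - x 0 * y 3) * (l1 • e 1 + l4 • e 2) k
      + (x 1 * y 0 - x 0 * y 1) * (-(l2 • e 2) + l1 • e 3) k := by
    conv_lhs => rw [expand x, expand y]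
    simp only [map_add, map_smul, LinearMap.add_apply, LinearMap.smul_apply, hself,
      hanti (e 2) (e 0), hanti (e 3) (e 1), hanti (e 2) (e 1), hanti (e 3) (e 2),
      hanti (e 0) (e 3), hanti (e 0) (e 1), h13, h24, h23, h34, h41, h21]
    simp only [Pi.add_apply, Pi.sub_apply, Pi.neg_apply, Pi.smul_apply, Pi.zero_apply, smul_eq_mul]
    ring
  have hskew (v y z : V) : gf (B v y) z + gf y (B v z) = 0 := by
    simp only [gf, hB]
    simp [e]
    ring
  have hder (v x y : V) : B v (B x y) = B (B v x) y + B x (B v y) := by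
    have h := hJac v x y
    rw [hanti (B x y) v, hanti (B y v) x, hanti y v, map_neg, neg_neg] at h
    linear_combination -h
  intro v x y z u
  have h := hskew v (B (B x y) z) u
  have hadd (a b c w : V) : gf (a + b + c) w = gf a w + gf b w + gf c w := by
    simp only [gf, Pi.add_apply]
    ring
  rw [hder, hder, map_add, LinearMap.add_apply, hadd] at h
  simp only [hR]
  linear_combination (-(1 / 4 : ℝ)) * h
end
end

section
/- Fix real numbers λ₁, λ₂, λ₃, λ₄ and let 𝔤 be the Lie algebra ℝ⁴ with bracket determined by [e₁,e₃] = λ₂e₂ + λ₄e₄, [e₂,e₄] = λ₁e₁ + λ₃e₃, [e₂,e₃] = −λ₂e₁ − λ₃e₄, [e₃,e₄] = −λ₄e₁ + λ₃e₂, [e₄,e₁] = λ₁e₂ + λ₄e₃, [e₂,e₁] = −λ₂e₃ + λ₁e₄, g the diagonal form of signature (2,2), and R(x,y,z,u) := −(1/4) g([[x,y],z],u). For each pair i ≠ j, the 2-plane spanned by eᵢ, eⱼ is non-degenerate and its sectional curvature k(eᵢ,eⱼ) := R(eᵢ,eⱼ,eⱼ,eᵢ)/(g(eⱼ,eⱼ)g(eᵢ,eᵢ)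 − g(eᵢ,eⱼ)²) satisfies: k(e₁,e₃) = −(1/4)(λ₂²−λ₄²), k(e₂,e₄) = −(1/4)(λ₁²−λ₃²), k(e₁,e₂) = −(1/4)(λ₁²+λ₂²), k(e₁,e₄) = −(1/4)(λ₁²−λ₄²), k(e₂,e₃) = −(1/4)(λ₂²−λ₃²), k(e₃,e₄) = (1/4)(λ₃²+λ₄²). -/
noncomputable section

/-- The basis 2-planes are non-degenerate, and their sectional curvatures. -/
theorem sectional_curvatures (l1 l2 l3 l4 : ℝ)
    (B : V →ₗ[ℝ] V →ₗ[ℝ] V)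
    (hanti : ∀ x y : V, B x y = -B y x)
    (h13 : B (e 0) (e 2) = l2 • e 1 + l4 • e 3)
    (h24 : B (e 1) (e 3) = l1 • e 0 + l3 • e 2)
    (h23 : B (e 1) (e 2) = -(l2 • e 0) - l3 • e 3)
    (h34 : B (e 2) (e 3) = -(l4 • e 0) + l3 • e 1)
    (h41 : B (e 3) (e 0) = l1 • e 1 + l4 • e 2)
    (h21 : B (e 1) (e 0) = -(l2 • e 2) + l1 • e 3)
    (hJac : ∀ x y z : V, B (B x y) z + B (B y z) x + B (B z x) y = 0)
    (R : V → V → V → V → ℝ)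
    (hR : ∀ x y z u : V, R x y z u = -(1 / 4 : ℝ) * gf (B (B x y) z) u)
    (k : V → V → ℝ)
    (hk : ∀ x y : V, k x y = R x y y x / (gf y y * gf x x - gf x y ^ 2))
    : (∀ i j : Fin 4, i ≠ j → gf (e j) (e j) * gf (e i) (e i) - gf (e i) (e j) ^ 2 ≠ 0) ∧
      k (e 0) (e 2) = -(1 / 4 : ℝ) * (l2 ^ 2 - l4 ^ 2) ∧
      k (e 1) (e 3) = -(1 / 4 : ℝ) * (l1 ^ 2 - l3 ^ 2) ∧
      k (e 0) (e 1) = -(1 / 4 : ℝ) * (l1 ^ 2 + l2 ^ 2) ∧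
      k (e 0) (e 3) = -(1 / 4 : ℝ) * (l1 ^ 2 - l4 ^ 2) ∧
      k (e 1) (e 2) = -(1 / 4 : ℝ) * (l2 ^ 2 - l3 ^ 2) ∧
      k (e 2) (e 3) = (1 / 4 : ℝ) * (l3 ^ 2 + l4 ^ 2) := by
  have h42 : B (e 3) (e 1) = -(l1 • e 0 + l3 • e 2) := by rw [hanti, h24]
  have h32 : B (e 2) (e 1) = -(-(l2 • e 0) - l3 • e 3) := by rw [hanti, h23]
  have h43 : B (e 3) (e 2) = -(-(l4 • e 0) + l3 • e 1) := by rw [hanti, h34]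
  have h14 : B (e 0) (e 3) = -(l1 • e 1 + l4 • e 2) := by rw [hanti, h41]
  have h12 : B (e 0) (e 1) = -(-(l2 • e 2) + l1 • e 3) := by rw [hanti, h21]
  refine ⟨?_, ?_, ?_, ?_, ?_, ?_, ?_⟩
  · intro i j hij
    fin_cases i <;> fin_cases j <;> simp [gf, e] at hij ⊢
  all_goals
    simp only [hk, hR, h13, h24, h23, h34, h42, h32, h43, h14, h12,
      map_add, map_sub, map_neg, map_smul, LinearMap.add_apply, LinearMap.sub_apply,
      LinearMap.neg_apply, LinearMap.smul_apply]
    simp [gf, e]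
    ring
end
end

section
/- Fix real numbers λ₁, λ₂, λ₃, λ₄ and consider the Lie algebra ℝ⁴ with bracket determined by [e₁,e₃] = λ₂e₂ + λ₄e₄, [e₂,e₄] = λ₁e₁ + λ₃e₃, [e₂,e₃] = −λ₂e₁ − λ₃e₄, [e₃,e₄] = −λ₄e₁ + λ₃e₂, [e₄,e₁] = λ₁e₂ + λ₄e₃, [e₂,e₁] = −λ₂e₃ + λ₁e₄, with g, J, εᵢ, F, N, R, ρ, τ as usual. Then the following four conditions are equivalent: (i) ‖∇J‖² := Σ_{i,k,p} εᵢεₖεₚ F(eᵢ,eₖ,eₚ)² = 0 (the manifold is isotropic Kähler); (ii) ‖N‖² := Σ_{i,j} εᵢεⱼ g(N(eᵢ,eⱼ),N(eᵢ,eⱼ)) = 0 (the Nijenhuis tensor is isotropic); (iii) λ₁² + λ₂² − λ₃² − λ₄² = 0; (iv) τ := Σᵢ εᵢ ρ(eᵢ,eᵢ) = 0 (the scalar curvature vanishes). -/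
noncomputable section

theorem e_zero : e 0 = ![1, 0, 0, 0] := by ext i; fin_cases i <;> simp [e]

theorem e_one : e 1 = ![0, 1, 0, 0] := by ext i; fin_cases i <;> simp [e]

theorem e_two : e 2 = ![0, 0, 1, 0] := by ext i; fin_cases i <;> simp [e]

theorem e_three : e 3 = ![0, 0, 0, 1] := by ext i; fin_cases i <;> simp [e]

/-- The four conditions — isotropic Kähler, isotropic Nijenhuis tensor,
λ₁²+λ₂²−λ₃²−λ₄² = 0, and vanishing scalar curvature — are equivalent. -/
theorem isotropic_Kaehler_tfae (l1 l2 l3 l4 : ℝ)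
    (B : V →ₗ[ℝ] V →ₗ[ℝ] V)
    (hanti : ∀ x y : V, B x y = -B y x)
    (h13 : B (e 0) (e 2) = l2 • e 1 + l4 • e 3)
    (h24 : B (e 1) (e 3) = l1 • e 0 + l3 • e 2)
    (h23 : B (e 1) (e 2) = -(l2 • e 0) - l3 • e 3)
    (h34 : B (e 2) (e 3) = -(l4 • e 0) + l3 • e 1)
    (h41 : B (e 3) (e 0) = l1 • e 1 + l4 • e 2)
    (h21 : B (e 1) (e 0) = -(l2 • e 2) + l1 • e 3)
    (hJac : ∀ x y z : V, B (B x y) z + B (B y z) x + B (B z x) y = 0)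
    (J : V →ₗ[ℝ] V)
    (hJ1 : J (e 0) = e 2) (hJ2 : J (e 1) = e 3)
    (hJ3 : J (e 2) = -e 0) (hJ4 : J (e 3) = -e 1)
    (F : V → V → V → ℝ)
    (hF : ∀ x y z : V,
      F x y z = gf ((1 / 2 : ℝ) • B x (J y) - (1 / 2 : ℝ) • J (B x y)) z)
    (N : V → V → V)
    (hN : ∀ x y : V,
      N x y = B x y + J (B (J x) y) + J (B x (J y)) - B (J x) (J y))
    (R : V → V → V → V → ℝ)
    (hR : ∀ x y z u : V, R x y z u = -(1 / 4 : ℝ) * gf (B (B x y) z) u)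
    (ρ : V → V → ℝ)
    (hρ : ∀ y z : V, ρ y z = ∑ i : Fin 4, eps i * R (e i) y z (e i))
    (τ : ℝ) (hτ : τ = ∑ i : Fin 4, eps i * ρ (e i) (e i))
    : [(∑ i : Fin 4, ∑ k : Fin 4, ∑ p : Fin 4,
          eps i * eps k * eps p * F (e i) (e k) (e p) ^ 2) = 0,
       (∑ i : Fin 4, ∑ j : Fin 4,
          eps i * eps j * gf (N (e i) (e j)) (N (e i) (e j))) = 0,
       l1 ^ 2 + l2 ^ 2 - l3 ^ 2 - l4 ^ 2 = 0,
       τ = 0].TFAE := by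
  have hself (x : V) : B x x = 0 := self_eq_neg.mp (hanti x x)
  have hB (x y : V) : B x y =
      ![l2 * (x 2 * y 1 - x 1 * y 2) + l1 * (x 1 * y 3 - x 3 * y 1)
          - l4 * (x 2 * y 3 - x 3 * y 2),
        l2 * (x 0 * y 2 - x 2 * y 0) + l3 * (x 2 * y 3 - x 3 * y 2)
          + l1 * (x 3 * y 0 - x 0 * y 3),
        l3 * (x 1 * y 3 - x 3 * y 1) + l4 * (x 3 * y 0 - x 0 * y 3)
          - l2 * (x 1 * y 0 - x 0 * y 1),
        l4 * (x 0 * y 2 - x 2 * y 0) - l3 * (x 1 * y 2 - x 2 * y 1)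
          + l1 * (x 1 * y 0 - x 0 * y 1)] := by
    conv_lhs => rw [eq_sum_smul_e x, eq_sum_smul_e y]
    simp only [map_add, map_smul, LinearMap.add_apply, LinearMap.smul_apply, hself,
      hanti (e 2) (e 0), hanti (e 3) (e 1), hanti (e 2) (e 1), hanti (e 3) (e 2),
      hanti (e 0) (e 3), hanti (e 0) (e 1), h13, h24, h23, h34, h41, h21]
    ext i
    fin_cases i <;> simp [e_zero, e_one, e_two, e_three] <;> ring
  have hJ (x : V) : J x = ![-x 2, -x 3, x 0, x 1] := by
    conv_lhs => rw [eq_sum_smul_e x]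
    simp only [map_add, map_smul, hJ1, hJ2, hJ3, hJ4]
    ext i
    fin_cases i <;> simp [e_zero, e_one, e_two, e_three]
  have hnormF : ∑ i : Fin 4, ∑ k : Fin 4, ∑ p : Fin 4,
      eps i * eps k * eps p * F (e i) (e k) (e p) ^ 2
        = 4 * (l1 ^ 2 + l2 ^ 2 - l3 ^ 2 - l4 ^ 2) := by
    simp [Fin.sum_univ_four, hF, hB, hJ, e_zero, e_one, e_two, e_three, gf, eps]
    ring
  have hnormN : ∑ i : Fin 4, ∑ j : Fin 4,
      eps i * eps j * gf (N (e i) (e j)) (N (e i) (e j))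
        = -32 * (l1 ^ 2 + l2 ^ 2 - l3 ^ 2 - l4 ^ 2) := by
    simp [Fin.sum_univ_four, hN, hB, hJ, e_zero, e_one, e_two, e_three, gf, eps]
    ring
  have hscal : τ = -(3 / 2) * (l1 ^ 2 + l2 ^ 2 - l3 ^ 2 - l4 ^ 2) := by
    simp [hτ, hρ, hR, Fin.sum_univ_four, hB, e_zero, e_one, e_two, e_three, gf, eps]
    ring
  rw [hnormF, hnormN, hscal]
  tfae_have 1 ↔ 3 := mul_eq_zero_iff_left (by norm_num)
  tfae_have 2 ↔ 3 := mul_eq_zero_iff_left (by norm_num)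
  tfae_have 4 ↔ 3 := mul_eq_zero_iff_left (by norm_num)
  tfae_finish
end
end
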